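/- arXiv:2509.12917 — 4 statements merged into one kernel-verified Lean document; each statement's English description precedes it below -/
import Mathlib

section
/- Let E be a complete real normed vector space (a real Banach space), let f : E → E be Lipschitz with constant k where 0 ≤ k < 1, and let q* be the unique fixed point of f (which exists by the Banach fixed point theorem). For every β with 0 < β < 2/(k+1), the sequences (y_n) and (z_n) generated by the reversible fixed-point iteration started from any initial pair (y_0, z_0) with y_0 = z_0 both converge to q*. -/
/-- One relaxed step contracts towards a fixed point `q` of a `k`-Lipschitz map. -/
lemma norm_relaxed_step_sub_le {E : Type*} [NormedAddCommGroup E] [NormedSpace ℝ E]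
    {f : E → E} {k : ℝ} (hf : ∀ a b : E, ‖f a - f b‖ ≤ k * ‖a - b‖)
    {q : E} (hq : f q = q) {β : ℝ} (hβ : 0 ≤ β) (u v : E) :
    ‖(1 - β) • u + β • f v - q‖ ≤ |1 - β| * ‖u - q‖ + β * k * ‖v - q‖ := by
  have h : (1 - β) • u + β • f v - q = (1 - β) • (u - q) + β • (f v - f q) := by
    rw [hq]; module
  rw [h, mul_assoc]
  refine (norm_add_le _ _).trans ?_
  rw [norm_smul, norm_smul, Real.norm_eq_abs, Real.norm_of_nonneg hβ]
  gcongr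
  exact hf v q

/-- The contraction factor of the relaxed step is less than one. -/
lemma abs_one_sub_add_mul_lt_one {k β : ℝ} (hk0 : 0 ≤ k) (hk1 : k < 1) (hβ0 : 0 < β)
    (hβ2 : β < 2 / (k + 1)) : |1 - β| + β * k < 1 := by
  rw [lt_div_iff₀ (by linarith)] at hβ2
  rcases abs_cases (1 - β) with ⟨h, -⟩ | ⟨h, -⟩ <;> rw [h] <;> nlinarith

/-- Theorem 1 (convergence of the reversible fixed-point iteration):
if `f` is a contraction with Lipschitz constant `0 ≤ k < 1` on a real Banach space,
`q` is its (unique) fixed point, and `0 < β < 2/(k+1)`, then both components of the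
reversible fixed-point iteration, started from any pair with `y 0 = z 0`,
converge to `q`. -/
theorem reversible_iteration_converges {E : Type*} [NormedAddCommGroup E]
    [NormedSpace ℝ E] [CompleteSpace E]
    (f : E → E) (k : ℝ) (hk0 : 0 ≤ k) (hk1 : k < 1)
    (hf : ∀ a b : E, ‖f a - f b‖ ≤ k * ‖a - b‖)
    (q : E) (hq : f q = q)
    (β : ℝ) (hβ0 : 0 < β) (hβ2 : β < 2 / (k + 1))
    (y z : ℕ → E) (h0 : y 0 = z 0)
    (hy : ∀ n, y (n + 1) = (1 - β) • y n + β • f (z n))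
    (hz : ∀ n, z (n + 1) = (1 - β) • z n + β • f (y (n + 1))) :
    Filter.Tendsto y Filter.atTop (nhds q) ∧
      Filter.Tendsto z Filter.atTop (nhds q) := by
  set c := |1 - β| + β * k with hc
  have hβk : 0 ≤ β * k := by positivity
  have hc0 : 0 ≤ c := by positivity
  have hc1 : c < 1 := abs_one_sub_add_mul_lt_one hk0 hk1 hβ0 hβ2
  have bound : ∀ n, ‖y n - q‖ ≤ c ^ n * ‖y 0 - q‖ ∧ ‖z n - q‖ ≤ c ^ n * ‖y 0 - q‖ := by
    intro n
    induction n with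
    | zero => simp [h0]
    | succ n ih =>
      obtain ⟨ihy, ihz⟩ := ih
      have hy' : ‖y (n + 1) - q‖ ≤ c ^ (n + 1) * ‖y 0 - q‖ := by
        calc ‖y (n + 1) - q‖ ≤ |1 - β| * ‖y n - q‖ + β * k * ‖z n - q‖ := by
              rw [hy]; exact norm_relaxed_step_sub_le hf hq hβ0.le _ _
          _ ≤ |1 - β| * (c ^ n * ‖y 0 - q‖) + β * k * (c ^ n * ‖y 0 - q‖) := by gcongr
          _ = c ^ (n + 1) * ‖y 0 - q‖ := by rw [pow_succ, hc]; ring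
      refine ⟨hy', ?_⟩
      have hle : c ^ (n + 1) ≤ c ^ n := pow_le_pow_of_le_one hc0 hc1.le n.le_succ
      calc ‖z (n + 1) - q‖ ≤ |1 - β| * ‖z n - q‖ + β * k * ‖y (n + 1) - q‖ := by
            rw [hz]; exact norm_relaxed_step_sub_le hf hq hβ0.le _ _
        _ ≤ |1 - β| * (c ^ n * ‖y 0 - q‖) + β * k * (c ^ n * ‖y 0 - q‖) := by
            gcongr
            exact hy'.trans (by gcongr)
        _ = c ^ (n + 1) * ‖y 0 - q‖ := by rw [pow_succ, hc]; ring
  have hlim : Filter.Tendsto (fun n => c ^ n * ‖y 0 - q‖) Filter.atTop (nhds 0) := by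
    simpa using (tendsto_pow_atTop_nhds_zero_of_lt_one hc0 hc1).mul_const ‖y 0 - q‖
  exact ⟨tendsto_iff_norm_sub_tendsto_zero.2
      (squeeze_zero (fun _ => norm_nonneg _) (fun n => (bound n).1) hlim),
    tendsto_iff_norm_sub_tendsto_zero.2
      (squeeze_zero (fun _ => norm_nonneg _) (fun n => (bound n).2) hlim)⟩
end

section
/- Let k be a real number with 0 ≤ k < 1 and let β be a real number with 0 < β < 2/(k+1). Then |1−β| + β·k·|1−β| + β²·k² < 1. -/
/-- For `0 ≤ k < 1` and `0 < β < 2/(k+1)`, the constant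
`L₂ = |1−β| + β·k·|1−β| + β²·k²` is strictly less than 1. -/
theorem L2_lt_one (k β : ℝ) (hk0 : 0 ≤ k) (hk1 : k < 1)
    (hβ0 : 0 < β) (hβ2 : β < 2 / (k + 1)) :
    |1 - β| + β * k * |1 - β| + β ^ 2 * k ^ 2 < 1 := by
  have hβk : β * (k + 1) < 2 := (lt_div_iff₀ (by linarith)).mp hβ2
  have hsum : |1 - β| + β * k < 1 := by
    rw [← lt_sub_iff_add_lt, abs_lt]
    constructor <;> nlinarith
  calc |1 - β| + β * k * |1 - β| + β ^ 2 * k ^ 2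
      = |1 - β| + β * k * (|1 - β| + β * k) := by ring
    _ ≤ |1 - β| + β * k := by
        exact add_le_add_right (mul_le_of_le_one_right (by positivity) hsum.le) _
    _ < 1 := hsum
end

section
/- Let k be a real number with 0 ≤ k < 1 and let β be a real number with 0 < β < 2/(k+1). Then |1−β| + β·k·|1−β| + β²·k² ≤ |1−β| + β·k. That is, the Lipschitz constant of the second component of the reversible iteration map is at most that of the first component, so max(L₁, L₂) = L₁ = |1−β| + β·k. -/
/-- The first Lipschitz constant is at most one in the admissible range of `β`. -/
lemma abs_one_sub_add_mul_le_one {k β : ℝ} (hk0 : 0 ≤ k) (hk1 : k < 1)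
    (hβ0 : 0 < β) (hβ2 : β < 2 / (k + 1)) : |1 - β| + β * k ≤ 1 := by
  have h : β * (k + 1) < 2 := (lt_div_iff₀ (by linarith)).1 hβ2
  have h' : β * k ≤ β := mul_le_of_le_one_right hβ0.le hk1.le
  have : |1 - β| ≤ 1 - β * k := abs_le.2 ⟨by linarith, by linarith⟩
  linarith

/-- For `0 ≤ k < 1` and `0 < β < 2/(k+1)`, the second Lipschitz constant `L₂`
is at most the first one `L₁ = |1−β| + β·k`. -/
theorem L2_le_L1 (k β : ℝ) (hk0 : 0 ≤ k) (hk1 : k < 1)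
    (hβ0 : 0 < β) (hβ2 : β < 2 / (k + 1)) :
    |1 - β| + β * k * |1 - β| + β ^ 2 * k ^ 2 ≤ |1 - β| + β * k := by
  have h : β * k * (|1 - β| + β * k) ≤ β * k :=
    mul_le_of_le_one_right (by positivity) (abs_one_sub_add_mul_le_one hk0 hk1 hβ0 hβ2)
  linarith
end

section
/- Let E be a complete real normed vector space (a real Banach space), let f : E → E be Lipschitz with constant k where 0 ≤ k < 1, and let β satisfy 0 < β < 2/(k+1). Define φ : E × E → E × E by φ(y, z) = ((1−β)·y + β·f(z), (1−β)·z + β·f((1−β)·y + β·f(z))). Then φ has a unique fixed point, and this fixed point equals (q*, q*) where q* is the unique fixed point of f. -/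
/-- A relaxed step `(1 - β) • y + β • w` with `β ≠ 0` is stationary at `y` only if `w = y`. -/
lemma eq_of_relaxed_step_eq {E : Type*} [AddCommGroup E] [Module ℝ E] {β : ℝ} (hβ : β ≠ 0)
    {y w : E} (h : (1 - β) • y + β • w = y) : w = y := by
  have h0 : β • (w - y) = 0 := by
    rw [← sub_eq_zero.mpr h]
    module
  exact sub_eq_zero.mp ((smul_eq_zero.mp h0).resolve_left hβ)

/-- Points whose distance is at most `k < 1` times itself coincide. -/
lemma eq_of_norm_sub_le_mul {E : Type*} [NormedAddCommGroup E] {k : ℝ} (hk : k < 1) {a b : E}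
    (h : ‖a - b‖ ≤ k * ‖a - b‖) : a = b := by
  have h0 : ‖a - b‖ ≤ 0 := by nlinarith [norm_nonneg (a - b)]
  exact sub_eq_zero.mp (norm_le_zero_iff.mp h0)

/-- On a real Banach space, for a contraction `f` with unique fixed point `q*` and
`0 < β < 2/(k+1)`, the reversible iteration map `φ` has a unique fixed point, which
equals `(q*, q*)`. -/
theorem reversible_map_unique_fixed_point {E : Type*} [NormedAddCommGroup E]
    [NormedSpace ℝ E] [CompleteSpace E]
    (f : E → E) (k : ℝ) (hk0 : 0 ≤ k) (hk1 : k < 1)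
    (hf : ∀ a b : E, ‖f a - f b‖ ≤ k * ‖a - b‖)
    (β : ℝ) (hβ0 : 0 < β) (hβ2 : β < 2 / (k + 1))
    (φ : E × E → E × E)
    (hφ : ∀ p : E × E,
      φ p = ((1 - β) • p.1 + β • f p.2,
             (1 - β) • p.2 + β • f ((1 - β) • p.1 + β • f p.2)))
    (qstar : E) (hq : f qstar = qstar) :
    (∃! p : E × E, φ p = p) ∧ φ (qstar, qstar) = (qstar, qstar) := by
  have hfix : φ (qstar, qstar) = (qstar, qstar) := by
    have hstep : (1 - β) • qstar + β • qstar = qstar := by module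
    simp only [hφ, hq, hstep]
  refine ⟨⟨(qstar, qstar), hfix, ?_⟩, hfix⟩
  rintro ⟨y, z⟩ hp
  simp only [hφ, Prod.mk.injEq] at hp
  obtain ⟨hy, hz⟩ := hp
  rw [hy] at hz
  have hfz : f z = y := eq_of_relaxed_step_eq hβ0.ne' hy
  have hfy : f y = z := eq_of_relaxed_step_eq hβ0.ne' hz
  have hyz : y = z := by
    apply eq_of_norm_sub_le_mul hk1
    have h := hf z y
    rwa [hfz, hfy, norm_sub_rev z y] at h
  subst hyz
  have hyq : y = qstar := by
    apply eq_of_norm_sub_le_mul hk1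
    have h := hf y qstar
    rwa [hfy, hq] at h
  rw [hyq]
end
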